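/- The Poincaré polynomial of A_n^+ is ∏_{k=1}^{n−1}(1 + kt): for each q ≥ 0, the ℚ-dimension of the degree-q homogeneous component of A_n^+ equals the coefficient of t^q in ∏_{k=1}^{n−1}(1 + kt), and the degree-q component is zero for q ≥ n. In particular dim_ℚ A_n^+ = n!. -/

import Mathlib

/-- Index set for the generators `a_{i,j}`, `i < j`, of `H^*(PΣ_n⁺; ℚ)`. -/
abbrev McIdx (n : ℕ) := {p : Fin n × Fin n // p.1 < p.2}

/-- The exterior algebra over `ℚ` on degree-one generators `a_{i,j}`, `i < j`. -/
abbrev McExt (n : ℕ) := ExteriorAlgebra ℚ (McIdx n →₀ ℚ)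

/-- The degree-one generator `a_{i,j}` (`i < j`) of the exterior algebra. -/
noncomputable def mcGen (n : ℕ) (p : McIdx n) : McExt n :=
  ExteriorAlgebra.ι ℚ (Finsupp.single p (1 : ℚ))

/-- The relations defining `H^*(PΣ_n⁺; ℚ)` as a quotient of the exterior algebra:
`a_{i,j} a_{i,k} - a_{i,j} a_{j,k} = 0` for `i < j < k`. -/
inductive McRel (n : ℕ) : McExt n → McExt n → Prop
  | tri {i j k : Fin n} (hij : i < j) (hjk : j < k) :
      McRel n (mcGen n ⟨(i, j), hij⟩ * mcGen n ⟨(i, k), hij.trans hjk⟩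
        - mcGen n ⟨(i, j), hij⟩ * mcGen n ⟨(j, k), hjk⟩) 0

/-- `A_n⁺ = E⁺/I⁺`, the rational cohomology ring of `PΣ_n⁺`. -/
abbrev McA (n : ℕ) := RingQuot (McRel n)

/-- The image `a_{i,j}` (`i < j`) in `A_n⁺` of the exterior generator. -/
noncomputable def mcA (n : ℕ) (p : McIdx n) : McA n :=
  RingQuot.mkAlgHom ℚ (McRel n) (mcGen n p)

/-- The degree-`q` homogeneous component of `A_n⁺`: since the defining ideal is homogeneous,
it is the image under the quotient map of the degree-`q` component `(range ι)^q` of the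
exterior algebra. -/
noncomputable def mcAComp (n q : ℕ) : Submodule ℚ (McA n) :=
  Submodule.map (RingQuot.mkAlgHom ℚ (McRel n)).toLinearMap
    ((LinearMap.range (ExteriorAlgebra.ι ℚ : (McIdx n →₀ ℚ) →ₗ[ℚ] McExt n)) ^ q)

/-- The generator `a_{i,j}` of `A_n⁺`, extended by zero to all pairs of indices. -/
noncomputable def mcVar {n : ℕ} (i j : Fin n) : McA n :=
  if h : i < j then mcA n ⟨(i, j), h⟩ else 0

theorem mcVar_of_lt {n : ℕ} {i j : Fin n} (h : i < j) : mcVar i j = mcA n ⟨(i, j), h⟩ :=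
  dif_pos h

theorem mcVar_of_le {n : ℕ} {i j : Fin n} (h : j ≤ i) : mcVar i j = 0 :=
  dif_neg h.not_gt

theorem mcA_mul_anticomm (n : ℕ) (p r : McIdx n) : mcA n p * mcA n r = -(mcA n r * mcA n p) := by
  rw [eq_neg_iff_add_eq_zero, mcA, mcA, ← map_mul, ← map_mul, ← map_add, mcGen, mcGen,
    ExteriorAlgebra.ι_add_mul_swap, map_zero]

theorem mcVar_mul_anticomm {n : ℕ} (i j k l : Fin n) :
    mcVar i j * mcVar k l = -(mcVar k l * mcVar i j) := by
  unfold mcVar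
  split_ifs
  · exact mcA_mul_anticomm n _ _
  all_goals simp

theorem mcVar_mul_self {n : ℕ} (i j : Fin n) : mcVar i j * mcVar i j = 0 :=
  have := IsAddTorsionFree.of_module_rat (McA n)
  self_eq_neg.mp (mcVar_mul_anticomm i j i j)

theorem mcVar_mul_mcVar {n : ℕ} {i j k : Fin n} (hjk : j < k) :
    mcVar i j * mcVar i k = mcVar i j * mcVar j k := by
  by_cases hij : i < j
  · rw [mcVar_of_lt hij, mcVar_of_lt hjk, mcVar_of_lt (hij.trans hjk), ← sub_eq_zero]
    simpa [mcA] using RingQuot.mkAlgHom_rel ℚ (McRel.tri hij hjk)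
  · simp [mcVar_of_le (not_lt.mp hij)]

/-- The defining relations in a form valid for all triples of indices. -/
theorem mcVar_triangle {n : ℕ} (i j k : Fin n) :
    mcVar i j * mcVar i k = mcVar i j * mcVar j k - mcVar i k * mcVar k j := by
  rcases lt_trichotomy j k with h | rfl | h
  · rw [mcVar_mul_mcVar h, mcVar_of_le h.le, mul_zero, sub_zero]
  · rw [mcVar_mul_self, mcVar_of_le le_rfl]
    simp
  · rw [mcVar_mul_anticomm, mcVar_mul_mcVar h, mcVar_of_le h.le, mul_zero, zero_sub]

/-- The universal property of `A_n⁺`. -/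
theorem exists_mcA_lift {n : ℕ} {B : Type*} [Ring B] [Algebra ℚ B] (G : Fin n → Fin n → B)
    (anticomm : ∀ i j k l, i < j → k < l → G i j * G k l = -(G k l * G i j))
    (tri : ∀ i j k, i < j → j < k → G i j * G i k = G i j * G j k) :
    ∃ φ : McA n →ₐ[ℚ] B, ∀ i j, i < j → φ (mcVar i j) = G i j := by
  let f : (McIdx n →₀ ℚ) →ₗ[ℚ] B := Finsupp.linearCombination ℚ fun p => G p.1.1 p.1.2
  have polar : (LinearMap.mul ℚ B).compl₁₂ f f + ((LinearMap.mul ℚ B).compl₁₂ f f).flip = 0 := by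
    ext p r
    simp [f, anticomm p.1.1 p.1.2 r.1.1 r.1.2 p.2 r.2]
  have square (v) : f v * f v = 0 := by
    have h := LinearMap.congr_fun₂ polar v v
    simp only [LinearMap.add_apply, LinearMap.compl₁₂_apply, LinearMap.mul_apply',
      LinearMap.flip_apply, LinearMap.zero_apply] at h
    have := IsAddTorsionFree.of_module_rat B
    exact self_eq_neg.mp (eq_neg_of_add_eq_zero_left h)
  let ψ : McExt n →ₐ[ℚ] B := ExteriorAlgebra.lift ℚ ⟨f, square⟩
  have hψ (p : McIdx n) : ψ (mcGen n p) = G p.1.1 p.1.2 := by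
    simp [ψ, mcGen, f]
  have hrel : ∀ ⦃x y⦄, McRel n x y → ψ x = ψ y := by
    rintro _ _ ⟨hij, hjk⟩
    simp [hψ, tri _ _ _ hij hjk]
  refine ⟨RingQuot.liftAlgHom ℚ ⟨ψ, hrel⟩, fun i j hij => ?_⟩
  rw [mcVar_of_lt hij, mcA, RingQuot.liftAlgHom_mkAlgHom_apply, hψ]

/-- The degree-one part of `A_n⁺`. -/
noncomputable def mcDegOne (n : ℕ) : Submodule ℚ (McA n) :=
  Submodule.span ℚ (Set.range (mcA n))

theorem mcVar_mem_mcDegOne {n : ℕ} (i j : Fin n) : mcVar i j ∈ mcDegOne n := by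
  unfold mcVar
  split_ifs with h
  · exact Submodule.subset_span ⟨_, rfl⟩
  · exact zero_mem _

theorem mkAlgHom_comp_ι (n : ℕ) :
    (RingQuot.mkAlgHom ℚ (McRel n)).toLinearMap ∘ₗ ExteriorAlgebra.ι ℚ =
      Finsupp.linearCombination ℚ (mcA n) := by
  ext p
  simp [mcA, mcGen]

theorem mcAComp_eq_pow (n q : ℕ) : mcAComp n q = mcDegOne n ^ q := by
  rw [mcAComp, Submodule.map_pow, ← LinearMap.range_comp, mkAlgHom_comp_ι,
    Finsupp.range_linearCombination, mcDegOne]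

theorem adjoin_range_mcA (n : ℕ) : Algebra.adjoin ℚ (Set.range (mcA n)) = ⊤ := by
  refine eq_top_iff.mpr fun a _ => ?_
  obtain ⟨x, rfl⟩ := RingQuot.mkAlgHom_surjective ℚ (McRel n) a
  induction x using ExteriorAlgebra.induction with
  | algebraMap r => rw [AlgHom.commutes]; exact algebraMap_mem _ r
  | ι v =>
    have h := LinearMap.mem_range_self (Finsupp.linearCombination ℚ (mcA n)) v
    rw [Finsupp.range_linearCombination, ← mkAlgHom_comp_ι] at h
    exact Algebra.span_le_adjoin ℚ _ h
  | mul x y hx hy => rw [map_mul]; exact mul_mem (hx trivial) (hy trivial)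
  | add x y hx hy => rw [map_add]; exact add_mem (hx trivial) (hy trivial)

theorem mcA_induction {n : ℕ} {C : McA n → Prop} (one : C 1)
    (smul : ∀ (c : ℚ) x, C x → C (c • x)) (add : ∀ x y, C x → C y → C (x + y))
    (mul : ∀ i j x, i < j → C x → C (mcVar i j * x)) (a : McA n) : C a := by
  have key (b : McA n) (hb : b ∈ Algebra.adjoin ℚ (Set.range (mcA n))) : ∀ x, C x → C (b * x) := by
    induction hb using Algebra.adjoin_induction with
    | mem y hy =>
      obtain ⟨⟨⟨i, j⟩, h⟩, rfl⟩ := hy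
      simpa only [mcVar_of_lt h] using fun x => mul i j x h
    | algebraMap c =>
      intro x hx
      rw [← Algebra.smul_def]
      exact smul c x hx
    | add y z _ _ hy hz =>
      intro x hx
      rw [add_mul]
      exact add _ _ (hy x hx) (hz x hx)
    | mul y z _ _ hy hz =>
      intro x hx
      rw [mul_assoc]
      exact hy _ (hz x hx)
  simpa using key a (by rw [adjoin_range_mcA]; trivial) 1 one

/-- The free `A_n⁺`-module underlying `A_{n+1}⁺`: `(x, y)` stands for
`x + ∑ j, a_{0,j} y_j`, where the indices of `A_n⁺` are shifted up by one. -/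
abbrev McExtension (n : ℕ) := McA n × (Fin n → McA n)

/-- The action of the generator `a_{i+1,j+1}` of `A_{n+1}⁺` on `McExtension n`. -/
noncomputable def mcSuccAct {n : ℕ} (i j : Fin n) : Module.End ℚ (McExtension n) where
  toFun m := (mcVar i j * m.1, fun l => -(mcVar i j * m.2 l))
  map_add' m m' := by
    ext <;> simp [mul_add, add_comm]
  map_smul' c m := by
    ext <;> simp

/-- The action of the generator `a_{0,j+1}` of `A_{n+1}⁺` on `McExtension n`. -/
noncomputable def mcZeroAct {n : ℕ} (j : Fin n) : Module.End ℚ (McExtension n) where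
  toFun m := (0, Pi.single j (m.1 + ∑ k, mcVar j k * m.2 k) - fun l => mcVar l j * m.2 l)
  map_add' m m' := by
    ext l
    · simp
    · rcases eq_or_ne l j with rfl | h
      · simp [mul_add, Finset.sum_add_distrib]; abel
      · simp [mul_add, h]; abel
  map_smul' c m := by
    ext l
    · simp
    · rcases eq_or_ne l j with rfl | h
      · simp [smul_sub, Finset.smul_sum]
      · simp [h]

theorem mcSuccAct_apply {n : ℕ} (i j : Fin n) (m : McExtension n) :
    mcSuccAct i j m = (mcVar i j * m.1, fun l => -(mcVar i j * m.2 l)) := rfl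

theorem mcZeroAct_apply {n : ℕ} (j : Fin n) (m : McExtension n) :
    mcZeroAct j m =
      (0, Pi.single j (m.1 + ∑ k, mcVar j k * m.2 k) - fun l => mcVar l j * m.2 l) := rfl

theorem mcSuccAct_mul_mcSuccAct {n : ℕ} (i j k l : Fin n) (m : McExtension n) :
    mcSuccAct i j (mcSuccAct k l m) =
      (mcVar i j * mcVar k l * m.1, fun r => mcVar i j * mcVar k l * m.2 r) := by
  simp [mcSuccAct_apply, mul_assoc]

theorem mcZeroAct_mul_mcSuccAct {n : ℕ} (j k l : Fin n) (m : McExtension n) :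
    mcZeroAct j (mcSuccAct k l m) = -mcSuccAct k l (mcZeroAct j m) := by
  ext r
  · simp [mcSuccAct_apply, mcZeroAct_apply]
  · have swap (a b : Fin n) (x : McA n) :
        mcVar a b * (mcVar k l * x) = -(mcVar k l * (mcVar a b * x)) := by
      rw [← mul_assoc, mcVar_mul_anticomm, neg_mul, mul_assoc]
    rcases eq_or_ne r j with rfl | h
    · simp [mcSuccAct_apply, mcZeroAct_apply, swap, mul_add, mul_sub, Finset.mul_sum]
    · simp [mcSuccAct_apply, mcZeroAct_apply, swap, h]

theorem mcZeroAct_mul_mcZeroAct {n : ℕ} (j k : Fin n) (m : McExtension n) :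
    mcZeroAct j (mcZeroAct k m) =
      (0, Pi.single j (mcVar j k * m.1 + ∑ l, mcVar j k * mcVar j l * m.2 l)
        - Pi.single k (mcVar k j * (m.1 + ∑ l, mcVar k l * m.2 l))
        + fun l => mcVar l j * mcVar l k * m.2 l) := by
  have coeff : ∑ l, mcVar j l * (mcZeroAct k m).2 l =
      mcVar j k * m.1 + ∑ l, mcVar j k * mcVar j l * m.2 l := by
    simp only [mcZeroAct_apply, Pi.sub_apply, mul_sub, Finset.sum_sub_distrib, Pi.single_apply,
      mul_ite, mul_zero, Finset.sum_ite_eq', Finset.mem_univ, if_true, mul_add,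
      Finset.mul_sum, mcVar_triangle j k, sub_mul, mul_assoc]
    abel
  rw [mcZeroAct_apply, coeff]
  ext r
  · rfl
  · rcases eq_or_ne r k with rfl | h
    · simp [mcZeroAct_apply, mul_sub, mul_assoc]; abel
    · simp [mcZeroAct_apply, h, mul_assoc]

theorem mcZeroAct_anticomm {n : ℕ} (j k : Fin n) (m : McExtension n) :
    mcZeroAct j (mcZeroAct k m) = -mcZeroAct k (mcZeroAct j m) := by
  rw [mcZeroAct_mul_mcZeroAct, mcZeroAct_mul_mcZeroAct]
  ext r
  · simp
  · simp only [Pi.add_apply, Pi.sub_apply, Prod.snd_neg, Pi.neg_apply, mul_add, Finset.mul_sum,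
      ← mul_assoc]
    rw [mcVar_mul_anticomm r k r j]
    noncomm_ring

theorem mcZeroAct_triangle {n : ℕ} {j k : Fin n} (h : j < k) (m : McExtension n) :
    mcZeroAct j (mcZeroAct k m) = mcZeroAct j (mcSuccAct j k m) := by
  rw [mcZeroAct_mul_mcZeroAct, mcVar_of_le h.le, mcZeroAct_apply]
  ext r
  · rfl
  · simp only [mcVar_mul_mcVar h, mcVar_mul_anticomm j k j, mcSuccAct_apply]
    simp [mul_assoc, Pi.single_apply]

/-- The generators of `A_{n+1}⁺` acting on `McExtension n`. -/
noncomputable def mcAct {n : ℕ} (i j : Fin (n + 1)) : Module.End ℚ (McExtension n) :=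
  Fin.cases 0 (fun l => Fin.cases (mcZeroAct l) (fun k => mcSuccAct k l) i) j

theorem mcAct_zero_succ {n : ℕ} (j : Fin n) : mcAct 0 j.succ = mcZeroAct j := rfl

theorem mcAct_succ_succ {n : ℕ} (i j : Fin n) : mcAct i.succ j.succ = mcSuccAct i j := rfl

theorem exists_mcRep (n : ℕ) : ∃ ρ : McA (n + 1) →ₐ[ℚ] Module.End ℚ (McExtension n),
    ∀ i j, i < j → ρ (mcVar i j) = mcAct i j := by
  refine exists_mcA_lift mcAct (fun i j k l hij hkl => ?_) (fun i j k hij hjk => ?_)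
  · obtain ⟨j, rfl⟩ := Fin.exists_succ_eq_of_ne_zero (Fin.ne_zero_of_lt hij)
    obtain ⟨l, rfl⟩ := Fin.exists_succ_eq_of_ne_zero (Fin.ne_zero_of_lt hkl)
    refine LinearMap.ext fun m => ?_
    rw [LinearMap.neg_apply, Module.End.mul_apply, Module.End.mul_apply]
    cases i using Fin.cases <;> cases k using Fin.cases <;>
      simp only [mcAct_zero_succ, mcAct_succ_succ]
    · exact mcZeroAct_anticomm _ _ _
    · exact mcZeroAct_mul_mcSuccAct _ _ _ _
    · rw [mcZeroAct_mul_mcSuccAct, neg_neg]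
    · rw [mcSuccAct_mul_mcSuccAct, mcSuccAct_mul_mcSuccAct, mcVar_mul_anticomm]
      ext <;> simp
  · obtain ⟨j, rfl⟩ := Fin.exists_succ_eq_of_ne_zero (Fin.ne_zero_of_lt hij)
    obtain ⟨k, rfl⟩ := Fin.exists_succ_eq_of_ne_zero (Fin.ne_zero_of_lt hjk)
    refine LinearMap.ext fun m => ?_
    rw [Module.End.mul_apply, Module.End.mul_apply]
    cases i using Fin.cases <;> simp only [mcAct_zero_succ, mcAct_succ_succ]
    · exact mcZeroAct_triangle (Fin.succ_lt_succ_iff.mp hjk) m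
    · rw [mcSuccAct_mul_mcSuccAct, mcSuccAct_mul_mcSuccAct,
        mcVar_mul_mcVar (Fin.succ_lt_succ_iff.mp hjk)]

theorem exists_mcShift (n : ℕ) : ∃ s : McA n →ₐ[ℚ] McA (n + 1),
    ∀ i j, s (mcVar i j) = mcVar i.succ j.succ := by
  obtain ⟨s, hs⟩ := exists_mcA_lift (n := n) (fun i j => mcVar i.succ j.succ)
    (fun _ _ _ _ _ _ => mcVar_mul_anticomm _ _ _ _)
    (fun _ _ _ _ hjk => mcVar_mul_mcVar (Fin.succ_lt_succ_iff.mpr hjk))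
  refine ⟨s, fun i j => ?_⟩
  rcases lt_or_ge i j with h | h
  · exact hs i j h
  · rw [mcVar_of_le h, mcVar_of_le (Fin.succ_le_succ_iff.mpr h), map_zero]

/-- The inclusion `A_n⁺ → A_{n+1}⁺` shifting indices up by one. -/
noncomputable def mcShift (n : ℕ) : McA n →ₐ[ℚ] McA (n + 1) := (exists_mcShift n).choose

theorem mcShift_mcVar {n : ℕ} (i j : Fin n) : mcShift n (mcVar i j) = mcVar i.succ j.succ :=
  (exists_mcShift n).choose_spec i j

/-- The comparison map `(x, y) ↦ x + ∑ j, a_{0,j} y_j` from `McExtension n` to `A_{n+1}⁺`. -/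
noncomputable def mcAssemble (n : ℕ) : McExtension n →ₗ[ℚ] McA (n + 1) where
  toFun m := mcShift n m.1 + ∑ j, mcVar 0 j.succ * mcShift n (m.2 j)
  map_add' m m' := by
    simp [mul_add, Finset.sum_add_distrib]; abel
  map_smul' c m := by
    simp [Finset.smul_sum]

theorem mcAssemble_apply {n : ℕ} (m : McExtension n) :
    mcAssemble n m = mcShift n m.1 + ∑ j, mcVar 0 j.succ * mcShift n (m.2 j) := rfl

theorem mcVar_mul_mcAssemble {n : ℕ} {i j : Fin (n + 1)} (h : i < j) (m : McExtension n) :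
    mcVar i j * mcAssemble n m = mcAssemble n (mcAct i j m) := by
  obtain ⟨j, rfl⟩ := Fin.exists_succ_eq_of_ne_zero (Fin.ne_zero_of_lt h)
  cases i using Fin.cases with
  | zero =>
    have step (k : Fin n) : mcVar 0 j.succ * (mcVar 0 k.succ * mcShift n (m.2 k)) =
        mcVar 0 j.succ * mcShift n (mcVar j k * m.2 k)
          - mcVar 0 k.succ * mcShift n (mcVar k j * m.2 k) := by
      rw [← mul_assoc, mcVar_triangle, sub_mul, map_mul, map_mul, mcShift_mcVar, mcShift_mcVar,
        mul_assoc, mul_assoc]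
    have single (x : McA n) :
        ∑ k, mcVar 0 k.succ * mcShift n ((Pi.single j x : Fin n → McA n) k) =
          mcVar 0 j.succ * mcShift n x := by
      rw [Finset.sum_eq_single j] <;> simp +contextual
    rw [mcAct_zero_succ, mcZeroAct_apply, mcAssemble_apply, mcAssemble_apply]
    simp only [Pi.sub_apply, map_sub, mul_sub, Finset.sum_sub_distrib, single, mul_add,
      Finset.mul_sum, step, map_add, map_sum, map_zero, zero_add]
    abel
  | succ i =>
    have step (k : Fin n) (x : McA (n + 1)) :
        mcVar i.succ j.succ * (mcVar 0 k.succ * x) =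
          -(mcVar 0 k.succ * (mcVar i.succ j.succ * x)) := by
      rw [← mul_assoc, mcVar_mul_anticomm, neg_mul, mul_assoc]
    rw [mcAct_succ_succ, mcSuccAct_apply, mcAssemble_apply, mcAssemble_apply]
    simp only [mul_add, Finset.mul_sum, step, map_neg, map_mul, mcShift_mcVar, mul_neg]

theorem mcAssemble_single {n : ℕ} (j : Fin n) (x : McA n) :
    mcAssemble n (0, Pi.single j x) = mcVar 0 j.succ * mcShift n x := by
  rw [mcAssemble_apply, Finset.sum_eq_single j] <;> simp +contextual

theorem mcAssemble_one (n : ℕ) : mcAssemble n (1, 0) = 1 := by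
  simp [mcAssemble_apply]

theorem mcAssemble_surjective (n : ℕ) : Function.Surjective (mcAssemble n) := by
  intro a
  induction a using mcA_induction with
  | one => exact ⟨_, mcAssemble_one n⟩
  | smul c x hx => obtain ⟨m, rfl⟩ := hx; exact ⟨c • m, map_smul _ _ _⟩
  | add x y hx hy =>
    obtain ⟨m, rfl⟩ := hx
    obtain ⟨m', rfl⟩ := hy
    exact ⟨m + m', map_add _ _ _⟩
  | mul i j x h hx => obtain ⟨m, rfl⟩ := hx; exact ⟨_, (mcVar_mul_mcAssemble h m).symm⟩

theorem mcAssemble_injective (n : ℕ) : Function.Injective (mcAssemble n) := by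
  obtain ⟨ρ, hρ⟩ := exists_mcRep n
  have shift (x : McA n) : ρ (mcShift n x) (1, 0) = (x, 0) := by
    induction x using mcA_induction with
    | one => simp
    | smul c x hx => simp [hx]
    | add x y hx hy => simp [hx, hy]
    | mul i j x h hx =>
      rw [map_mul, mcShift_mcVar, map_mul, hρ _ _ (Fin.succ_lt_succ_iff.mpr h),
        Module.End.mul_apply, hx, mcAct_succ_succ, mcSuccAct_apply]
      ext <;> simp
  refine Function.LeftInverse.injective (g := fun a => ρ a (1, 0)) fun m => ?_
  rw [mcAssemble_apply]
  simp only [map_add, map_sum, map_mul, LinearMap.add_apply, LinearMap.sum_apply,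
    Module.End.mul_apply, shift, hρ _ _ (Fin.succ_pos _), mcAct_zero_succ, mcZeroAct_apply]
  ext r
  · simp [Prod.fst_sum]
  · simp [Prod.snd_sum, Pi.single_apply]

/-- The summand of `McExtension n` that assembles to the degree-`q + 1` part of `A_{n+1}⁺`,
parametrised by the degree-`q + 1` and degree-`q` parts of `A_n⁺`. -/
noncomputable def mcExtensionDeg (n q : ℕ) :
    ((mcDegOne n ^ (q + 1) : Submodule ℚ (McA n)) ×
      (Fin n → (mcDegOne n ^ q : Submodule ℚ (McA n)))) →ₗ[ℚ] McExtension n :=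
  (Submodule.subtype _).prodMap ((Submodule.subtype _).compLeft (Fin n))

theorem mcExtensionDeg_injective (n q : ℕ) : Function.Injective (mcExtensionDeg n q) := by
  rintro ⟨x, y⟩ ⟨x', y'⟩ h
  have h₁ : (x : McA n) = x' := congrArg Prod.fst h
  have h₂ (j : Fin n) : (y j : McA n) = y' j := congrFun (congrArg Prod.snd h) j
  exact Prod.ext (Subtype.ext h₁) (funext fun j => Subtype.ext (h₂ j))

theorem mem_range_mcExtensionDeg {n q : ℕ} {m : McExtension n} :
    m ∈ LinearMap.range (mcExtensionDeg n q) ↔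
      m.1 ∈ mcDegOne n ^ (q + 1) ∧ ∀ j, m.2 j ∈ mcDegOne n ^ q := by
  constructor
  · rintro ⟨⟨x, y⟩, rfl⟩
    exact ⟨x.2, fun j => (y j).2⟩
  · rintro ⟨h₁, h₂⟩
    exact ⟨(⟨_, h₁⟩, fun j => ⟨_, h₂ j⟩), rfl⟩

theorem mcVar_mul_mem_pow_succ {n q : ℕ} (i j : Fin n) {x : McA n} (hx : x ∈ mcDegOne n ^ q) :
    mcVar i j * x ∈ mcDegOne n ^ (q + 1) := by
  rw [pow_succ']
  exact Submodule.mul_mem_mul (mcVar_mem_mcDegOne i j) hx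

theorem mcShift_mem_pow {n q : ℕ} {x : McA n} (hx : x ∈ mcDegOne n ^ q) :
    mcShift n x ∈ mcDegOne (n + 1) ^ q := by
  have h : (mcDegOne n).map (mcShift n).toLinearMap ≤ mcDegOne (n + 1) := by
    rw [mcDegOne, Submodule.map_span_le]
    rintro _ ⟨⟨⟨i, j⟩, hij⟩, rfl⟩
    rw [← mcVar_of_lt hij, AlgHom.toLinearMap_apply, mcShift_mcVar]
    exact mcVar_mem_mcDegOne _ _
  refine pow_le_pow_left' h q ?_
  rw [← Submodule.map_pow]
  exact Submodule.mem_map_of_mem hx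

theorem mcDegOne_mul_le {n : ℕ} {P R : Submodule ℚ (McA n)}
    (h : ∀ i j, i < j → ∀ x ∈ P, mcVar i j * x ∈ R) : mcDegOne n * P ≤ R := by
  refine Submodule.mul_le.mpr fun a ha x hx => ?_
  induction ha using Submodule.span_induction with
  | mem a ha =>
    obtain ⟨⟨⟨i, j⟩, hij⟩, rfl⟩ := ha
    simpa only [mcVar_of_lt hij] using h i j hij x hx
  | zero => simp
  | add a b _ _ ha hb => rw [add_mul]; exact add_mem ha hb
  | smul c a _ ha => rw [smul_mul_assoc]; exact R.smul_mem c ha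

theorem mcAct_mem_range {n q : ℕ} (i j : Fin (n + 1)) {m : McExtension n}
    (hm : m ∈ LinearMap.range (mcExtensionDeg n q)) :
    mcAct i j m ∈ LinearMap.range (mcExtensionDeg n (q + 1)) := by
  rw [mem_range_mcExtensionDeg] at hm ⊢
  obtain ⟨h₁, h₂⟩ := hm
  cases j using Fin.cases with
  | zero => exact ⟨zero_mem _, fun _ => zero_mem _⟩
  | succ j =>
    cases i using Fin.cases with
    | zero =>
      have hsum : m.1 + ∑ k, mcVar j k * m.2 k ∈ mcDegOne n ^ (q + 1) :=
        add_mem h₁ (sum_mem fun k _ => mcVar_mul_mem_pow_succ _ _ (h₂ k))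
      have hsingle (l : Fin n) : (Pi.single j (m.1 + ∑ k, mcVar j k * m.2 k) : Fin n → McA n) l ∈
          mcDegOne n ^ (q + 1) := by
        rw [Pi.single_apply]
        split_ifs
        · exact hsum
        · exact zero_mem _
      exact ⟨zero_mem _, fun l => sub_mem (hsingle l) (mcVar_mul_mem_pow_succ l j (h₂ l))⟩
    | succ i =>
      exact ⟨mcVar_mul_mem_pow_succ _ _ h₁, fun l => neg_mem (mcVar_mul_mem_pow_succ _ _ (h₂ l))⟩

theorem range_mcAssemble_comp (n q : ℕ) :
    LinearMap.range (mcAssemble n ∘ₗ mcExtensionDeg n q) = mcDegOne (n + 1) ^ (q + 1) := by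
  rw [LinearMap.range_comp]
  apply le_antisymm
  · rintro _ ⟨m, hm, rfl⟩
    obtain ⟨h₁, h₂⟩ := mem_range_mcExtensionDeg.mp hm
    exact add_mem (mcShift_mem_pow h₁)
      (sum_mem fun j _ => mcVar_mul_mem_pow_succ _ _ (mcShift_mem_pow (h₂ j)))
  · induction q with
    | zero =>
      rw [pow_succ']
      refine mcDegOne_mul_le fun i j hij x hx => ?_
      rw [pow_zero, Submodule.mem_one] at hx
      obtain ⟨c, rfl⟩ := hx
      rw [← Algebra.commutes, ← Algebra.smul_def]
      refine Submodule.smul_mem _ c ?_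
      rw [← mul_one (mcVar i j), ← mcAssemble_one, mcVar_mul_mcAssemble hij]
      refine Submodule.mem_map_of_mem (mem_range_mcExtensionDeg.mpr ?_)
      obtain ⟨j, rfl⟩ := Fin.exists_succ_eq_of_ne_zero (Fin.ne_zero_of_lt hij)
      cases i using Fin.cases with
      | zero =>
        simp only [mcAct_zero_succ, mcZeroAct_apply, Pi.zero_apply, mul_zero, pow_zero]
        refine ⟨zero_mem _, fun l => ?_⟩
        rcases eq_or_ne l j with rfl | h
        · simpa using Submodule.one_le.mp (le_refl (1 : Submodule ℚ (McA n)))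
        · simp [h]
      | succ i =>
        simpa [mcAct_succ_succ, mcSuccAct_apply] using mcVar_mem_mcDegOne i j
    | succ q ih =>
      rw [pow_succ']
      refine mcDegOne_mul_le fun i j hij x hx => ?_
      obtain ⟨m, hm, rfl⟩ := ih hx
      rw [mcVar_mul_mcAssemble hij]
      exact Submodule.mem_map_of_mem (mcAct_mem_range i j hm)

/-- `A_{n+1}⁺` is free over `A_n⁺` on `1, a_{0,1}, …, a_{0,n}`. -/
noncomputable def mcAssembleEquiv (n : ℕ) : McExtension n ≃ₗ[ℚ] McA (n + 1) :=
  LinearEquiv.ofBijective (mcAssemble n) ⟨mcAssemble_injective n, mcAssemble_surjective n⟩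

theorem mcA_one_algebraMap_surjective : Function.Surjective (algebraMap ℚ (McA 1)) := by
  intro a
  induction a using mcA_induction with
  | one => exact ⟨1, map_one _⟩
  | smul c x hx => obtain ⟨r, rfl⟩ := hx; exact ⟨c * r, by rw [map_mul, Algebra.smul_def]⟩
  | add x y hx hy =>
    obtain ⟨r, rfl⟩ := hx
    obtain ⟨r', rfl⟩ := hy
    exact ⟨r + r', map_add _ _ _⟩
  | mul i j x h => exact absurd h (by simp)

theorem exists_mcA_augmentation (n : ℕ) : Nonempty (McA n →ₐ[ℚ] ℚ) :=
  let ⟨φ, _⟩ := exists_mcA_lift (n := n) (B := ℚ) 0 (by simp) (by simp)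
  ⟨φ⟩

instance mcA_nontrivial (n : ℕ) : Nontrivial (McA n) :=
  (exists_mcA_augmentation n).some.toRingHom.domain_nontrivial

/-- `A_1⁺` is the ground field. -/
noncomputable def mcAOneEquiv : ℚ ≃ₗ[ℚ] McA 1 :=
  LinearEquiv.ofBijective (Algebra.linearMap ℚ (McA 1))
    ⟨(algebraMap ℚ (McA 1)).injective, mcA_one_algebraMap_surjective⟩

theorem mcA_finite (n : ℕ) : Module.Finite ℚ (McA (n + 1)) := by
  induction n with
  | zero => exact Module.Finite.equiv mcAOneEquiv
  | succ n ih => exact Module.Finite.equiv (mcAssembleEquiv (n + 1))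

theorem finrank_mcA (n : ℕ) : Module.finrank ℚ (McA (n + 1)) = (n + 1).factorial := by
  induction n with
  | zero => simp [← mcAOneEquiv.finrank_eq]
  | succ n ih =>
    have := mcA_finite n
    rw [← (mcAssembleEquiv (n + 1)).finrank_eq, Module.finrank_prod, Module.finrank_pi_fintype]
    simp only [ih, Finset.sum_const, Finset.card_univ, Fintype.card_fin, smul_eq_mul]
    rw [Nat.factorial_succ (n + 1)]
    ring

theorem mcDegOne_one : mcDegOne 1 = ⊥ := by
  refine Submodule.span_eq_bot.mpr ?_
  rintro _ ⟨⟨⟨i, j⟩, h⟩, rfl⟩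
  exact absurd h (by simp)

theorem finrank_mcDegOne_pow_zero (n : ℕ) :
    Module.finrank ℚ (mcDegOne n ^ 0 : Submodule ℚ (McA n)) = 1 := by
  rw [pow_zero, Submodule.one_eq_span]
  exact finrank_span_singleton one_ne_zero

theorem finrank_mcDegOne_pow_succ (n q : ℕ) :
    Module.finrank ℚ (mcDegOne (n + 2) ^ (q + 1) : Submodule ℚ (McA (n + 2))) =
      Module.finrank ℚ (mcDegOne (n + 1) ^ (q + 1) : Submodule ℚ (McA (n + 1))) +
        (n + 1) * Module.finrank ℚ (mcDegOne (n + 1) ^ q : Submodule ℚ (McA (n + 1))) := by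
  have := mcA_finite n
  have inj : Function.Injective (mcAssemble (n + 1) ∘ₗ mcExtensionDeg (n + 1) q) :=
    (mcAssemble_injective _).comp (mcExtensionDeg_injective _ _)
  rw [← range_mcAssemble_comp, LinearMap.finrank_range_of_inj inj, Module.finrank_prod,
    Module.finrank_pi_fintype]
  simp

theorem finrank_mcDegOne_pow (n q : ℕ) :
    Module.finrank ℚ (mcDegOne (n + 1) ^ q : Submodule ℚ (McA (n + 1))) =
      (∏ k ∈ Finset.range n,
        (Polynomial.C (k + 1) * Polynomial.X + 1 : Polynomial ℕ)).coeff q := by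
  induction n generalizing q with
  | zero =>
    cases q with
    | zero => simp [finrank_mcDegOne_pow_zero]
    | succ q => rw [mcDegOne_one, pow_succ, Submodule.mul_bot]; simp [Polynomial.coeff_one]
  | succ n ih =>
    rw [Finset.prod_range_succ, mul_add, mul_one, Polynomial.coeff_add, ← mul_assoc]
    cases q with
    | zero =>
      rw [Polynomial.coeff_mul_X_zero, zero_add, ← ih]
      simp only [finrank_mcDegOne_pow_zero]
    | succ q =>
      rw [Polynomial.coeff_mul_X, Polynomial.coeff_mul_C, finrank_mcDegOne_pow_succ, ih, ih]
      ring

theorem mcDegOne_pow_eq_bot {n q : ℕ} (h : n < q) : mcDegOne (n + 1) ^ q = ⊥ := by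
  have := mcA_finite n
  rw [← Submodule.finrank_eq_zero (R := ℚ), finrank_mcDegOne_pow]
  refine Polynomial.coeff_eq_zero_of_natDegree_lt (lt_of_le_of_lt ?_ h)
  refine (Polynomial.natDegree_prod_le _ _).trans ?_
  refine (Finset.sum_le_card_nsmul _ _ 1 fun k _ => ?_).trans (by simp)
  compute_degree

/-- The Poincaré polynomial of `A_n⁺` is `∏_{k=1}^{n-1} (1 + kt)`: the
`ℚ`-dimension of the degree-`q` component of `A_n⁺` equals the coefficient of `t^q` in
`∏_{k=1}^{n-1} (1 + kt)`, and the degree-`q` component vanishes for `q ≥ n`.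
In particular `dim_ℚ A_n⁺ = n!`. -/
theorem mcA_poincare_polynomial (n : ℕ) (hn : 2 ≤ n) :
    (∀ q : ℕ, Module.finrank ℚ (mcAComp n q)
      = (∏ k ∈ Finset.range (n - 1),
          (Polynomial.C (k + 1) * Polynomial.X + 1 : Polynomial ℕ)).coeff q) ∧
    (∀ q : ℕ, n ≤ q → mcAComp n q = ⊥) ∧
    Module.finrank ℚ (McA n) = Nat.factorial n := by
  obtain ⟨n, rfl⟩ := Nat.exists_eq_add_of_le' (one_le_two.trans hn)
  refine ⟨fun q => ?_, fun q hq => ?_, finrank_mcA n⟩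
  · rw [mcAComp_eq_pow, finrank_mcDegOne_pow, Nat.add_sub_cancel]
  · rw [mcAComp_eq_pow, mcDegOne_pow_eq_bot hq]
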